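/- arXiv:math/0601516 — 4 statements merged into one kernel-verified Lean document; each statement's English description precedes it below -/
import Mathlib

section
/- For every i ∈ ℤ/rℤ one has 0 ≤ ι_i ≤ e − 1; that is, α_{i+1} − β_{i+1} + e·δ_J(i+1) lies in the interval [0, e−1]. -/
open Finset

/-- Indicator function (as an integer) of a subset `J ⊆ ℤ/rℤ`:
`dlt J i = 1` if `i ∈ J` and `0` otherwise.  Note that the indicator of the
complement `Jᶜ` is `1 - dlt J i`. -/
def dlt {r : ℕ} (J : Finset (ZMod r)) (i : ZMod r) : ℤ :=
  if i ∈ J then 1 else 0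

/-- `α_i = Σ_{j=0}^{r−1} p^{r−1−j} (b_{i+j} δ_{J^c}(i+j) − δ_{J^c}(i+j+1))`. -/
def alph (p r : ℕ) (J : Finset (ZMod r)) (b : ZMod r → ℤ) (i : ZMod r) : ℤ :=
  ∑ j ∈ Finset.range r, (p : ℤ) ^ (r - 1 - j) *
    (b (i + (j : ZMod r)) * (1 - dlt J (i + (j : ZMod r))) -
      (1 - dlt J (i + (j : ZMod r) + 1)))

/-- `β_i = Σ_{j=0}^{r−1} p^{r−1−j} (b_{i+j} δ_J(i+j) − δ_J(i+j+1))`. -/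
def bet (p r : ℕ) (J : Finset (ZMod r)) (b : ZMod r → ℤ) (i : ZMod r) : ℤ :=
  ∑ j ∈ Finset.range r, (p : ℤ) ^ (r - 1 - j) *
    (b (i + (j : ZMod r)) * dlt J (i + (j : ZMod r)) -
      dlt J (i + (j : ZMod r) + 1))

/-- `ι_i = α_{i+1} − β_{i+1} + e·δ_J(i+1)`, where `e = p^r − 1`. -/
def iot (p r : ℕ) (J : Finset (ZMod r)) (b : ZMod r → ℤ) (i : ZMod r) : ℤ :=
  alph p r J b (i + 1) - bet p r J b (i + 1) + ((p : ℤ) ^ r - 1) * dlt J (i + 1)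

lemma dlt_eq_zero_or_one {r : ℕ} (J : Finset (ZMod r)) (i : ZMod r) :
    dlt J i = 0 ∨ dlt J i = 1 := by
  unfold dlt
  split_ifs <;> simp

/-- A telescoping sum in base `q`. -/
lemma sum_range_pow_mul_telescope (q : ℤ) (f : ℕ → ℤ) (n : ℕ) :
    ∑ j ∈ range n, q ^ (n - 1 - j) * (q * f j - f (j + 1)) = q ^ n * f 0 - f n := by
  have key : ∀ j ∈ range n, q ^ (n - 1 - j) * (q * f j - f (j + 1)) =
      q ^ (n - j) * f j - q ^ (n - (j + 1)) * f (j + 1) := by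
    intro j hj
    have hj' := mem_range.1 hj
    obtain ⟨k, rfl⟩ : ∃ k, n = j + 1 + k := ⟨n - (j + 1), by omega⟩
    rw [show j + 1 + k - 1 - j = k by omega, show j + 1 + k - j = k + 1 by omega,
      Nat.add_sub_cancel_left]
    ring
  rw [sum_congr rfl key, sum_range_sub' fun j => q ^ (n - j) * f j]
  simp

/-- The base `p` expansion of `ι_i`. -/
lemma iot_eq_sum (p r : ℕ) (J : Finset (ZMod r)) (b : ZMod r → ℤ) (i : ZMod r) :
    iot p r J b i = ∑ j ∈ range r, (p : ℤ) ^ (r - 1 - j) *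
      (b (i + 1 + (j : ZMod r)) * (1 - 2 * dlt J (i + 1 + (j : ZMod r))) +
        p * dlt J (i + 1 + (j : ZMod r)) - 1 + dlt J (i + 1 + (j : ZMod r) + 1)) := by
  have h := sum_range_pow_mul_telescope p (fun j => dlt J (i + 1 + (j : ZMod r))) r
  simp only [Nat.cast_zero, add_zero, CharP.cast_eq_zero, Nat.cast_add, Nat.cast_one,
    ← add_assoc] at h
  rw [iot, sub_mul, one_mul, ← h, alph, bet, ← sum_sub_distrib, ← sum_add_distrib]
  refine sum_congr rfl fun j _ => ?_
  ring

/-- For every i, 0 ≤ ι_i ≤ e - 1, i.e. α_(i+1) - β_(i+1) + e*δ_J(i+1) lies in [0, e-1]. -/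
theorem stmt4 (p r : ℕ) (hp : p.Prime) (hp5 : 5 ≤ p) (hr : 1 ≤ r)
    (J : Finset (ZMod r)) (b : ZMod r → ℤ)
    (hb : ∀ i : ZMod r, 2 ≤ b i ∧ b i ≤ (p : ℤ) - 2) :
    ∀ i : ZMod r, 0 ≤ iot p r J b i ∧ iot p r J b i ≤ ((p : ℤ) ^ r - 1) - 1 := by
  intro i
  have hp0 : (0 : ℤ) < p := by exact_mod_cast hp.pos
  have digit_bounds : ∀ k : ZMod r,
      0 ≤ b k * (1 - 2 * dlt J k) + p * dlt J k - 1 + dlt J (k + 1) ∧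
        b k * (1 - 2 * dlt J k) + p * dlt J k - 1 + dlt J (k + 1) < p - 1 := by
    intro k
    obtain ⟨h1, h2⟩ := hb k
    rcases dlt_eq_zero_or_one J k with h | h <;>
      rcases dlt_eq_zero_or_one J (k + 1) with h' | h' <;>
      rw [h, h'] <;> constructor <;> linarith
  rw [iot_eq_sum]
  constructor
  · exact sum_nonneg fun j _ => mul_nonneg (by positivity) (digit_bounds _).1
  · have h := sum_range_pow_mul_telescope p (fun _ => 1) r
    simp only [mul_one] at h
    rw [← h, Int.le_sub_one_iff]
    exact sum_lt_sum_of_nonempty (nonempty_range_iff.2 (by omega)) fun j _ =>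
      mul_lt_mul_of_pos_left (digit_bounds _).2 (by positivity)
end

section
/- For every i ∈ ℤ/rℤ with i+1 ∈ J, one has the congruence n_i − β_{i+1} ≡ n'_i + ι_i (mod p). -/
open Finset

/-- `n_i = (p−2−δ_{J^c}(i)·b_i)·e + p·δ_{J^c}(i)·α_i − δ_{J^c}(i+1)·α_{i+1}`,
where `e = p^r − 1`. -/
def nn (p r : ℕ) (J : Finset (ZMod r)) (b : ZMod r → ℤ) (i : ZMod r) : ℤ :=
  ((p : ℤ) - 2 - (1 - dlt J i) * b i) * ((p : ℤ) ^ r - 1) +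
    (p : ℤ) * (1 - dlt J i) * alph p r J b i -
      (1 - dlt J (i + 1)) * alph p r J b (i + 1)

/-- `n'_i = (p−2−δ_J(i)·b_i)·e + p·δ_J(i)·β_i − δ_J(i+1)·β_{i+1}`,
where `e = p^r − 1`. -/
def nn' (p r : ℕ) (J : Finset (ZMod r)) (b : ZMod r → ℤ) (i : ZMod r) : ℤ :=
  ((p : ℤ) - 2 - dlt J i * b i) * ((p : ℤ) ^ r - 1) +
    (p : ℤ) * dlt J i * bet p r J b i -
      dlt J (i + 1) * bet p r J b (i + 1)

/-- Modulo `p`, a sum `∑ j < r, p ^ (r - 1 - j) * f j` reduces to its last term. -/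
theorem sum_pow_mul_modEq_last (p r : ℕ) (hr : 1 ≤ r) (f : ℕ → ℤ) :
    ∑ j ∈ Finset.range r, (p : ℤ) ^ (r - 1 - j) * f j ≡ f (r - 1) [ZMOD (p : ℤ)] := by
  obtain ⟨s, rfl⟩ : ∃ s, r = s + 1 := ⟨r - 1, by omega⟩
  have h : (p : ℤ) ∣ ∑ j ∈ Finset.range s, (p : ℤ) ^ (s - j) * f j :=
    Finset.dvd_sum fun j hj =>
      (dvd_pow_self _ (by have := Finset.mem_range.mp hj; omega)).mul_right _
  simpa [Finset.sum_range_succ] using (Int.modEq_zero_iff_dvd.mpr h).add_right (f s)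

theorem add_one_add_natCast_pred {r : ℕ} (hr : 1 ≤ r) (i : ZMod r) :
    i + 1 + ((r - 1 : ℕ) : ZMod r) = i := by
  simp [Nat.cast_sub hr]

theorem alph_add_one_modEq (p r : ℕ) (hr : 1 ≤ r) (J : Finset (ZMod r)) (b : ZMod r → ℤ)
    (i : ZMod r) :
    alph p r J b (i + 1) ≡ b i * (1 - dlt J i) - (1 - dlt J (i + 1)) [ZMOD (p : ℤ)] := by
  have h := sum_pow_mul_modEq_last p r hr fun j =>
    b (i + 1 + (j : ZMod r)) * (1 - dlt J (i + 1 + (j : ZMod r))) -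
      (1 - dlt J (i + 1 + (j : ZMod r) + 1))
  simpa only [alph, add_one_add_natCast_pred hr] using h

theorem bet_add_one_modEq (p r : ℕ) (hr : 1 ≤ r) (J : Finset (ZMod r)) (b : ZMod r → ℤ)
    (i : ZMod r) :
    bet p r J b (i + 1) ≡ b i * dlt J i - dlt J (i + 1) [ZMOD (p : ℤ)] := by
  have h := sum_pow_mul_modEq_last p r hr fun j =>
    b (i + 1 + (j : ZMod r)) * dlt J (i + 1 + (j : ZMod r)) -
      dlt J (i + 1 + (j : ZMod r) + 1)
  simpa only [bet, add_one_add_natCast_pred hr] using h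

/-- For every i with i+1 ∈ J, n_i - β_(i+1) ≡ n'_i + ι_i mod p. -/
theorem stmt8 (p r : ℕ) (hp : p.Prime) (hp5 : 5 ≤ p) (hr : 1 ≤ r)
    (J : Finset (ZMod r)) (b : ZMod r → ℤ)
    (hb : ∀ i : ZMod r, 2 ≤ b i ∧ b i ≤ (p : ℤ) - 2) :
    ∀ i : ZMod r, i + 1 ∈ J →
      nn p r J b i - bet p r J b (i + 1) ≡ nn' p r J b i + iot p r J b i [ZMOD (p : ℤ)] := by
  intro i hi
  have hd : dlt J (i + 1) = 1 := if_pos hi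
  obtain ⟨x, hx⟩ := (alph_add_one_modEq p r hr J b i).dvd
  obtain ⟨y, hy⟩ := (bet_add_one_modEq p r hr J b i).dvd
  obtain ⟨z, hz⟩ : (p : ℤ) ∣ (p : ℤ) ^ r := dvd_pow_self _ (by omega)
  rw [hd] at hx hy
  have hα : alph p r J b (i + 1) = b i * (1 - dlt J i) - p * x := by linarith
  have hβ : bet p r J b (i + 1) = b i * dlt J i - 1 - p * y := by linarith
  refine Int.modEq_iff_dvd.mpr
    ⟨z + b i * (1 - 2 * dlt J i) * z - x + y + dlt J i * bet p r J b i -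
      (1 - dlt J i) * alph p r J b i, ?_⟩
  unfold nn nn' iot
  rw [hd, hα, hβ, hz]
  ring
end

section
/- Let J ⊆ ℤ/rℤ and let c_i (i ∈ ℤ/rℤ) be integers with c_i ≥ 1 and 2 ≤ c_i + δ_J(i+1) ≤ p − 2. Let Z ⊆ ℤ/rℤ, let Y = {i ∈ ℤ/rℤ : δ_Z(i) ≠ δ_Z(i+1)}, and let X ⊆ ℤ/rℤ satisfy X ∩ Y = Y ∩ Z. If Σ_{i∈ℤ/rℤ} (c_i + δ_J(i+1))·w(i) ≡ Σ_{i∈Z} c_i·w(i) + Σ_{i∈X} w(i) (mod p^r − 1), then Z = ℤ/rℤ and X = {i ∈ ℤ/rℤ : i+1 ∈ J}. (This is the combinatorial core of the proposition that if a reducible local representation is compatible with a regular weight via J and has a lift of type J, then it has a model of type J.) -/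
open Finset

/-- `w(i) = p^((r − i.val) % r)`, so that `p·w(i+1) ≡ w(i) (mod p^r − 1)`. -/
def wgt (p r : ℕ) (i : ZMod r) : ℤ := (p : ℤ) ^ ((r - i.val) % r)

theorem wgt_neg (p r : ℕ) [NeZero r] (i : ZMod r) : wgt p r (-i) = (p : ℤ) ^ i.val := by
  rw [wgt, ← ZMod.neg_val', neg_neg]

theorem abs_sum_mul_pow_mul_le {p m : ℤ} (hp : 1 ≤ p) :
    ∀ {n : ℕ} (d : Fin n → ℤ), (∀ i, |d i| ≤ m) →
      |∑ i, d i * p ^ (i : ℕ)| * (p - 1) ≤ m * (p ^ n - 1)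
  | 0, _, _ => by simp
  | n + 1, d, hd => by
    have ih := abs_sum_mul_pow_mul_le hp (fun i => d (Fin.castSucc i)) fun i => hd _
    rw [Fin.sum_univ_castSucc]
    simp only [Fin.val_castSucc, Fin.val_last]
    have hpow : 0 ≤ p ^ n := by positivity
    have hlast : |d (Fin.last n) * p ^ n| ≤ m * p ^ n := by
      rw [abs_mul, abs_of_nonneg hpow]
      exact mul_le_mul_of_nonneg_right (hd _) hpow
    calc _ ≤ (|∑ i : Fin n, d i.castSucc * p ^ (i : ℕ)| + m * p ^ n) * (p - 1) :=
          mul_le_mul_of_nonneg_right ((abs_add_le _ _).trans (by gcongr)) (by linarith)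
      _ ≤ m * (p ^ (n + 1) - 1) := by linear_combination ih

theorem eq_zero_of_sum_mul_pow_eq_zero {p : ℤ} (hp : 0 < p) :
    ∀ {n : ℕ} (d : Fin n → ℤ), (∀ i, |d i| < p) → ∑ i, d i * p ^ (i : ℕ) = 0 → ∀ i, d i = 0
  | 0, _, _, _ => fun i => i.elim0
  | n + 1, d, hd, h => by
    have hfactor : d 0 + p * ∑ i : Fin n, d i.succ * p ^ (i : ℕ) = 0 := by
      rw [← h, Fin.sum_univ_succ, Finset.mul_sum]
      simp only [Fin.val_zero, pow_zero, mul_one, Fin.val_succ, pow_succ]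
      congr 1
      exact Finset.sum_congr rfl fun i _ => by ring
    have h0 : d 0 = 0 :=
      Int.eq_zero_of_abs_lt_dvd ⟨-_, by rw [mul_neg]; exact eq_neg_of_add_eq_zero_left hfactor⟩
        (hd 0)
    rw [h0, zero_add] at hfactor
    exact Fin.cases h0 (eq_zero_of_sum_mul_pow_eq_zero hp (fun i => d i.succ) (fun i => hd _)
      ((mul_eq_zero.mp hfactor).resolve_left hp.ne'))

/-- Digits of absolute value at most `p - 2` whose weighted sum is divisible by `p ^ r - 1` all
vanish. -/
theorem eq_zero_of_dvd_sum_mul_wgt {p r : ℕ} [NeZero r] (hp : 2 ≤ p) (d : ZMod r → ℤ)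
    (hd : ∀ i, |d i| ≤ (p : ℤ) - 2) (h : (p : ℤ) ^ r - 1 ∣ ∑ i, d i * wgt p r i) (i : ZMod r) :
    d i = 0 := by
  have hp' : (2 : ℤ) ≤ p := by exact_mod_cast hp
  have hneg : ∑ i, d i * wgt p r i = ∑ i : ZMod r, d (-i) * (p : ℤ) ^ i.val := by
    rw [← Equiv.sum_comp (Equiv.neg (ZMod r))]
    simp [wgt_neg]
  rw [hneg] at h
  obtain ⟨n, rfl⟩ := Nat.exists_eq_succ_of_ne_zero (NeZero.ne r)
  have hbound := abs_sum_mul_pow_mul_le (p := p) (by linarith)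
    (fun j : Fin (n + 1) => d (-(j : ZMod (n + 1)))) fun j => hd _
  have hpow : (1 : ℤ) < (p : ℤ) ^ (n + 1) := one_lt_pow₀ (by linarith) (Nat.succ_ne_zero n)
  have hlt : |∑ j : Fin (n + 1), d (-(j : ZMod (n + 1))) * (p : ℤ) ^ (j : ℕ)| <
      (p : ℤ) ^ (n + 1) - 1 := by
    by_contra! hle
    nlinarith [mul_le_mul_of_nonneg_right hle (show (0 : ℤ) ≤ p - 1 by linarith)]
  have hzero := eq_zero_of_sum_mul_pow_eq_zero (p := p) (by linarith)
    (fun j : Fin (n + 1) => d (-(j : ZMod (n + 1)))) (fun j => by linarith [hd (-j)])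
    (Int.eq_zero_of_abs_lt_dvd h hlt)
  exact (congrArg d (neg_neg i)).symm.trans (hzero (-i : ZMod (n + 1)))

/-- The combinatorial core of Proposition `liftimpliesmodel`: if `c_i ≥ 1`,
`2 ≤ c_i + δ_J(i+1) ≤ p − 2`, `Y` is the boundary of `Z`, `X ∩ Y = Y ∩ Z`,
and the displayed congruence holds modulo `p^r − 1`, then `Z = ℤ/rℤ` and
`X = {i : i+1 ∈ J}`. -/
theorem stmt15 (p r : ℕ) [NeZero r] (hp : p.Prime) (hp5 : 5 ≤ p)
    (J : Finset (ZMod r)) (c : ZMod r → ℤ)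
    (hc1 : ∀ i : ZMod r, 1 ≤ c i)
    (hc2 : ∀ i : ZMod r, 2 ≤ c i + dlt J (i + 1) ∧ c i + dlt J (i + 1) ≤ (p : ℤ) - 2)
    (Z X Y : Finset (ZMod r))
    (hY : Y = Finset.univ.filter (fun i : ZMod r => ¬ ((i ∈ Z) ↔ (i + 1 ∈ Z))))
    (hX : X ∩ Y = Y ∩ Z)
    (hcong : (∑ i : ZMod r, (c i + dlt J (i + 1)) * wgt p r i) ≡
      (∑ i ∈ Z, c i * wgt p r i) + (∑ i ∈ X, wgt p r i) [ZMOD (p : ℤ) ^ r - 1]) :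
    Z = Finset.univ ∧ X = Finset.univ.filter (fun i : ZMod r => i + 1 ∈ J) := by
  have hdig : ∀ i, c i * (1 - dlt Z i) + dlt J (i + 1) - dlt X i = 0 := by
    refine eq_zero_of_dvd_sum_mul_wgt (p := p) (by omega) _ (fun i => ?_) ?_
    · have h1 := hc1 i
      have h2 := hc2 i
      have hp' : (5 : ℤ) ≤ p := by exact_mod_cast hp5
      unfold dlt at *
      rw [abs_le]
      split_ifs at * <;> constructor <;> linarith
    · convert hcong.symm.dvd using 1
      have hind (S : Finset (ZMod r)) (f : ZMod r → ℤ) :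
          ∑ i ∈ S, f i = ∑ i, dlt S i * f i := by
        simp [dlt]
      rw [hind Z, hind X, ← Finset.sum_add_distrib, ← Finset.sum_sub_distrib]
      exact Finset.sum_congr rfl fun i _ => by ring
  have hZ : ∀ i, i ∈ Z := fun i => by
    by_contra hi
    have h1 := hdig i
    have h2 := hc2 i
    have h3 : dlt X i ≤ 1 := by unfold dlt; split_ifs <;> norm_num
    have h4 : dlt Z i = 0 := if_neg hi
    rw [h4] at h1
    linarith
  refine ⟨Finset.eq_univ_of_forall hZ, Finset.ext fun i => ?_⟩
  have h1 := hdig i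
  rw [show dlt Z i = 1 from if_pos (hZ i)] at h1
  unfold dlt at h1
  split_ifs at h1 <;> simp_all
end

section
/- Suppose J' ⊆ ℤ/2rℤ is a full subset and K' ⊆ ℤ/rℤ, and suppose that Σ_{i∈ℤ/2rℤ} a_{K_J,π(i)}·w₂(i) + Σ_{i∈J} b_{K_J,π(i)}·w₂(i) ≡ Σ_{i∈ℤ/2rℤ} a_{K',π(i)}·w₂(i) + Σ_{i∈J'} b_{K',π(i)}·w₂(i) (mod p^{2r} − 1). Then K' = K_J. (This is the combinatorial content of the proposition that, for an irreducible local representation compatible with a regular weight σ_{a,b} via a full subset J, σ_{a,b} is the unique Jordan–Hölder factor of the mod-p reduction of the cuspidal type I'_{a,b,J} compatible with that representation.) -/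
open Finset

/-- `w₂(i) = p^((2r − i.val) % (2r))`, so that `p·w₂(i+1) ≡ w₂(i) (mod p^{2r} − 1)`. -/
def wgt2 (p r : ℕ) (i : ZMod (2 * r)) : ℤ := (p : ℤ) ^ ((2 * r - i.val) % (2 * r))

/-- The natural surjection `π : ℤ/2rℤ → ℤ/rℤ`. -/
def prj (r : ℕ) : ZMod (2 * r) →+* ZMod r := ZMod.castHom (dvd_mul_left r 2) (ZMod r)

/-- A subset `H ⊆ ℤ/2rℤ` is full if `|H| = r` and `π` is injective on `H`. -/
def IsFull (r : ℕ) (H : Finset (ZMod (2 * r))) : Prop :=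
  H.card = r ∧ Set.InjOn (prj r) ↑H

/-- `K_J = π(J ∩ {1̄, …, r̄}) ⊆ ℤ/rℤ`. -/
def KJset (r : ℕ) (J : Finset (ZMod (2 * r))) : Finset (ZMod r) :=
  ((J ∩ (Finset.Icc 1 r).image (Nat.cast : ℕ → ZMod (2 * r)))).image (prj r)

/-- The integers `c_i` attached to `b` and `K_J` (irreducible case). -/
def cIrr (p r : ℕ) (b : ZMod r → ℤ) (KJ : Finset (ZMod r)) (i : ZMod r) : ℤ :=
  if i = 0 then
    (if i ∈ KJ then b i + dlt KJ 1 - 1 else (p : ℤ) - b i + dlt KJ 1 - 1)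
  else
    (if i ∈ KJ then b i - dlt KJ (i + 1) else (p : ℤ) - b i - dlt KJ (i + 1))

/-- The integers `a_{K,i}` (irreducible case). -/
def aIrr (p r : ℕ) (b : ZMod r → ℤ) (KJ K : Finset (ZMod r)) (i : ZMod r) : ℤ :=
  if i = 0 then
    (if i ∈ K then dlt K 1 else cIrr p r b KJ i + 1)
  else
    (if i ∈ K then 0 else cIrr p r b KJ i + dlt K (i + 1))

/-- The integers `b_{K,i}` (irreducible case). -/
def bIrr (p r : ℕ) (b : ZMod r → ℤ) (KJ K : Finset (ZMod r)) (i : ZMod r) : ℤ :=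
  if i = 0 then
    (if i ∈ K then cIrr p r b KJ i + 1 - dlt K 1 else (p : ℤ) - cIrr p r b KJ i + dlt K 1 - 1)
  else
    (if i ∈ K then cIrr p r b KJ i + dlt K (i + 1) else (p : ℤ) - cIrr p r b KJ i - dlt K (i + 1))

/-- A divisibility of a base-`q` expansion by `q ^ n - 1` yields a cyclic system of carries. -/
lemma exists_carries_nat (q : ℤ) (hq : q ≠ 0) (n : ℕ) (d : ℕ → ℤ)
    (h : q ^ n - 1 ∣ ∑ m ∈ range n, d m * q ^ m) :
    ∃ T : ℕ → ℤ, T n = T 0 ∧ ∀ m < n, d m + T m = q * T (m + 1) := by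
  obtain ⟨c, hc⟩ := h
  have key : ∀ k ≤ n, ∃ u, (∑ m ∈ range k, d m * q ^ m) + c = q ^ k * u := by
    intro k hk
    have h1 : q ^ k ∣ ∑ m ∈ Ico k n, d m * q ^ m :=
      dvd_sum fun m hm => (pow_dvd_pow q (mem_Ico.1 hm).1).mul_left _
    have h2 := sum_range_add_sum_Ico (fun m => d m * q ^ m) hk
    have h3 : (∑ m ∈ range k, d m * q ^ m) + c
        = q ^ n * c - ∑ m ∈ Ico k n, d m * q ^ m := by linarith
    rw [h3]
    exact dvd_sub ((pow_dvd_pow q hk).mul_right _) h1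
  have key' : ∀ k, ∃ u, k ≤ n → (∑ m ∈ range k, d m * q ^ m) + c = q ^ k * u := fun k => by
    by_cases hk : k ≤ n
    · obtain ⟨u, hu⟩ := key k hk
      exact ⟨u, fun _ => hu⟩
    · exact ⟨0, fun h => absurd h hk⟩
  choose T hT using key'
  refine ⟨T, ?_, fun m hm => ?_⟩
  · have h0 := hT 0 (Nat.zero_le _)
    have hn := hT n le_rfl
    simp only [range_zero, sum_empty, zero_add, pow_zero, one_mul] at h0
    rw [← h0]
    apply mul_left_cancel₀ (pow_ne_zero n hq)
    linarith
  · have h0 := hT m hm.le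
    have h1 := hT (m + 1) hm
    rw [sum_range_succ] at h1
    apply mul_left_cancel₀ (pow_ne_zero m hq)
    rw [pow_succ] at h1
    linear_combination h1 - h0

lemma exists_carries {p r : ℕ} [NeZero r] [NeZero (2 * r)] (hp : p ≠ 0) (D : ZMod (2 * r) → ℤ)
    (h : (p : ℤ) ^ (2 * r) - 1 ∣ ∑ i, D i * wgt2 p r i) :
    ∃ t : ZMod (2 * r) → ℤ, ∀ i, D i + t (i + 1) = p * t i := by
  have hr : 0 < r := Nat.pos_of_neZero r
  have hval : ∀ i : ZMod (2 * r), (-i).val = (2 * r - i.val) % (2 * r) := fun i => ZMod.neg_val' i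
  have hsum : ∑ i, D i * wgt2 p r i
      = ∑ m ∈ range (2 * r), D (-(m : ZMod (2 * r))) * (p : ℤ) ^ m := by
    refine sum_bij' (fun i _ => (-i).val) (fun m _ => -(m : ZMod (2 * r))) ?_ ?_ ?_ ?_ ?_
    · intro i _
      exact mem_range.2 (ZMod.val_lt _)
    · simp
    · intro i _
      simp
    · intro m hm
      rw [neg_neg, ZMod.val_cast_of_lt (mem_range.1 hm)]
    · intro i _
      rw [ZMod.natCast_zmod_val, neg_neg, wgt2, hval]
  rw [hsum] at h
  obtain ⟨T, hT0, hT⟩ := exists_carries_nat p (by exact_mod_cast hp) (2 * r)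
    (fun m => D (-(m : ZMod (2 * r)))) h
  refine ⟨fun i => T (1 - i).val, fun i => ?_⟩
  have h1 := hT (-i).val (ZMod.val_lt _)
  rw [ZMod.natCast_zmod_val, neg_neg] at h1
  have h2 : T ((-i).val + 1) = T (1 - i).val := by
    have h3 : (1 - i).val = ((-i).val + 1) % (2 * r) := by
      rw [sub_eq_neg_add, ZMod.val_add, ZMod.val_one'' (by omega)]
    have h4 := ZMod.val_lt (-i)
    rcases Nat.lt_or_ge ((-i).val + 1) (2 * r) with h5 | h5
    · rw [h3, Nat.mod_eq_of_lt h5]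
    · have h6 : (-i).val + 1 = 2 * r := by omega
      rw [h3, h6, Nat.mod_self, hT0]
  have h7 : 1 - (i + 1) = -i := by ring
  simp only [h7]
  rw [← h2, ← h1]

/-- Carries of digits of absolute value at most `p` lie in `{-1, 0, 1}`. -/
lemma abs_carry_le_one {n : ℕ} [NeZero n] {p : ℤ} (hp : 3 ≤ p) {D t : ZMod n → ℤ}
    (hD : ∀ i, |D i| ≤ p) (h : ∀ i, D i + t (i + 1) = p * t i) (i : ZMod n) : |t i| ≤ 1 := by
  obtain ⟨m, hm⟩ := Finite.exists_max fun i => |t i|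
  refine (hm i).trans ?_
  have h1 : p * |t m| ≤ p + |t m| := by
    calc p * |t m| = |D m + t (m + 1)| := by rw [h m, abs_mul, abs_of_nonneg (by linarith : 0 ≤ p)]
      _ ≤ |D m| + |t (m + 1)| := abs_add_le _ _
      _ ≤ p + |t m| := add_le_add (hD m) (hm _)
  by_contra! h2
  nlinarith

/-- `i` is one of the classes `1̄, …, r̄`. -/
def InFirstHalf (r : ℕ) (i : ZMod (2 * r)) : Prop := 1 ≤ i.val ∧ i.val ≤ r

lemma prj_eq_natCast_val {r : ℕ} [NeZero (2 * r)] (i : ZMod (2 * r)) :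
    prj r i = (i.val : ZMod r) := by
  rw [prj, ZMod.castHom_apply, ZMod.cast_eq_val]

lemma prj_add_one {r : ℕ} (i : ZMod (2 * r)) : prj r (i + 1) = prj r i + 1 := by simp

lemma prj_add_self {r : ℕ} (i : ZMod (2 * r)) : prj r (i + r) = prj r i := by simp

lemma prj_eq_zero_iff {r : ℕ} [NeZero (2 * r)] (i : ZMod (2 * r)) : prj r i = 0 ↔ i.val = 0 ∨ i.val = r := by
  rw [prj_eq_natCast_val, ZMod.natCast_eq_zero_iff]
  have h := ZMod.val_lt i
  constructor
  · rintro ⟨k, hk⟩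
    have : k < 2 := by
      by_contra! h2
      nlinarith
    interval_cases k <;> simp [hk]
  · rintro (h | h) <;> simp [h]

lemma eq_or_eq_add_of_prj_eq {r : ℕ} [NeZero (2 * r)] {i j : ZMod (2 * r)} (h : prj r i = prj r j) :
    i = j ∨ i = j + r := by
  have h1 : prj r (i - j) = 0 := by rw [map_sub, h, sub_self]
  rcases (prj_eq_zero_iff _).1 h1 with h2 | h2
  · exact Or.inl (sub_eq_zero.1 ((ZMod.val_eq_zero _).1 h2))
  · right
    have h3 : ((i - j).val : ZMod (2 * r)) = r := congrArg _ h2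
    rw [ZMod.natCast_zmod_val] at h3
    exact sub_eq_iff_eq_add'.1 h3

section Positions

variable {r : ℕ} [NeZero r] [NeZero (2 * r)]

lemma val_add_one_eq (i : ZMod (2 * r)) : (i + 1).val = (i.val + 1) % (2 * r) := by
  have hr : 0 < r := Nat.pos_of_neZero r
  rw [ZMod.val_add, ZMod.val_one'' (by omega)]

lemma val_add_self_eq (i : ZMod (2 * r)) :
    (i + r).val = if i.val < r then i.val + r else i.val - r := by
  have hr : 0 < r := Nat.pos_of_neZero r
  have hi := ZMod.val_lt i
  rw [ZMod.val_add, ZMod.val_cast_of_lt (by omega)]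
  split_ifs with h
  · exact Nat.mod_eq_of_lt (by omega)
  · rw [Nat.mod_eq_sub_mod (by omega), Nat.mod_eq_of_lt (by omega)]
    omega

lemma inFirstHalf_add_self (i : ZMod (2 * r)) : InFirstHalf r (i + r) ↔ ¬ InFirstHalf r i := by
  have hr : 0 < r := Nat.pos_of_neZero r
  have hi := ZMod.val_lt i
  unfold InFirstHalf
  rw [val_add_self_eq]
  split_ifs <;> omega

lemma inFirstHalf_add_one_iff (i : ZMod (2 * r)) :
    InFirstHalf r (i + 1) ↔ (InFirstHalf r i ↔ prj r i ≠ 0) := by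
  have hr : 0 < r := Nat.pos_of_neZero r
  have hi := ZMod.val_lt i
  unfold InFirstHalf
  rw [Ne, prj_eq_zero_iff, val_add_one_eq]
  rcases Nat.lt_or_ge (i.val + 1) (2 * r) with h | h
  · rw [Nat.mod_eq_of_lt h]
    omega
  · rw [show i.val + 1 = 2 * r by omega, Nat.mod_self]
    omega

lemma eq_zero_of_not_inFirstHalf {i : ZMod (2 * r)} (h : ¬ InFirstHalf r i) (h0 : prj r i = 0) :
    i = 0 := by
  have hr : 0 < r := Nat.pos_of_neZero r
  rw [prj_eq_zero_iff] at h0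
  unfold InFirstHalf at h
  exact (ZMod.val_eq_zero i).1 (by omega)

lemma exists_prj_eq_not_inFirstHalf (x : ZMod r) : ∃ i, prj r i = x ∧ ¬ InFirstHalf r i := by
  have h : prj r (x.val : ZMod (2 * r)) = x := by simp
  by_cases hi : InFirstHalf r (x.val : ZMod (2 * r))
  · exact ⟨x.val + r, by rw [prj_add_self, h], by rw [inFirstHalf_add_self]; exact not_not.2 hi⟩
  · exact ⟨_, h, hi⟩

lemma IsFull.add_mem_iff {H : Finset (ZMod (2 * r))} (hH : IsFull r H) (i : ZMod (2 * r)) :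
    i + r ∈ H ↔ i ∉ H := by
  constructor
  · intro h1 h2
    have h3 := hH.2 (mem_coe.2 h1) (mem_coe.2 h2) (prj_add_self i)
    have h4 := inFirstHalf_add_self i
    rw [h3] at h4
    tauto
  · intro h
    have himg : H.image (prj r) = univ := by
      apply eq_univ_of_card
      rw [card_image_of_injOn hH.2, hH.1, ZMod.card]
    obtain ⟨j, hj, hji⟩ := mem_image.1 (himg ▸ mem_univ (prj r i))
    rcases eq_or_eq_add_of_prj_eq hji with rfl | rfl
    · exact absurd hj h
    · exact hj

lemma mem_KJset_iff {J : Finset (ZMod (2 * r))} (x : ZMod r) :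
    x ∈ KJset r J ↔ ∃ i ∈ J, InFirstHalf r i ∧ prj r i = x := by
  have hr : 0 < r := Nat.pos_of_neZero r
  have key : ∀ i : ZMod (2 * r),
      i ∈ (Icc 1 r).image (Nat.cast : ℕ → ZMod (2 * r)) ↔ InFirstHalf r i := by
    intro i
    simp only [mem_image, mem_Icc]
    constructor
    · rintro ⟨m, hm, rfl⟩
      unfold InFirstHalf
      rwa [ZMod.val_cast_of_lt (by omega)]
    · exact fun h => ⟨i.val, h, ZMod.natCast_zmod_val i⟩
  simp only [KJset, mem_image (f := prj r), mem_inter, key, and_assoc]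

lemma IsFull.mem_iff {J : Finset (ZMod (2 * r))} (hJ : IsFull r J) (i : ZMod (2 * r)) :
    i ∈ J ↔ (InFirstHalf r i ↔ prj r i ∈ KJset r J) := by
  have key : ∀ i, InFirstHalf r i → (prj r i ∈ KJset r J ↔ i ∈ J) := by
    intro i hi
    rw [mem_KJset_iff]
    constructor
    · rintro ⟨j, hj, hj1, hji⟩
      rcases eq_or_eq_add_of_prj_eq hji with rfl | rfl
      · exact hj
      · exact absurd hi ((inFirstHalf_add_self i).1 hj1)
    · exact fun h => ⟨i, h, hi, rfl⟩
  by_cases hi : InFirstHalf r i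
  · have := key i hi
    tauto
  · have h1 := key (i + r) ((inFirstHalf_add_self i).2 hi)
    rw [prj_add_self, hJ.add_mem_iff] at h1
    tauto

end Positions

/-- The coefficient of `w₂(i)` in `Σ a_{K,π(i)} w₂(i) + Σ_{i ∈ H} b_{K,π(i)} w₂(i)`. -/
def coeffIrr (p r : ℕ) (b : ZMod r → ℤ) (KJ K : Finset (ZMod r)) (H : Finset (ZMod (2 * r)))
    (i : ZMod (2 * r)) : ℤ :=
  aIrr p r b KJ K (prj r i) + if i ∈ H then bIrr p r b KJ K (prj r i) else 0

/-- The multiple of `p` to be moved from position `i` to position `i - 1`. -/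
def shiftIrr (r : ℕ) (K : Finset (ZMod r)) (H : Finset (ZMod (2 * r))) (i : ZMod (2 * r)) : ℤ :=
  if i ∈ H ∧ prj r i ∉ K then 1 else 0

/-- The coefficient of `w₂(i)` once all multiples of `p` have been moved. -/
def digitIrr (p r : ℕ) (b : ZMod r → ℤ) (KJ K : Finset (ZMod r)) (H : Finset (ZMod (2 * r)))
    (i : ZMod (2 * r)) : ℤ :=
  coeffIrr p r b KJ K H i - p * shiftIrr r K H i + shiftIrr r K H (i + 1)

lemma sum_coeffIrr (p r : ℕ) [NeZero (2 * r)] (b : ZMod r → ℤ) (KJ K : Finset (ZMod r))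
    (H : Finset (ZMod (2 * r))) :
    ∑ i, coeffIrr p r b KJ K H i * wgt2 p r i
      = (∑ i, aIrr p r b KJ K (prj r i) * wgt2 p r i)
        + ∑ i ∈ H, bIrr p r b KJ K (prj r i) * wgt2 p r i := by
  simp only [coeffIrr, add_mul, sum_add_distrib, ite_mul, zero_mul, sum_ite_mem, univ_inter]

lemma digitIrr_of_ne_zero {p r : ℕ} {b : ZMod r → ℤ} {KJ K : Finset (ZMod r)}
    {H : Finset (ZMod (2 * r))} {i : ZMod (2 * r)} (hi : prj r i ≠ 0) :
    digitIrr p r b KJ K H i =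
      (if i ∈ H ↔ prj r i ∈ K then cIrr p r b KJ (prj r i) + dlt K (prj r i + 1) else 0)
        + if i + 1 ∈ H ∧ prj r i + 1 ∉ K then 1 else 0 := by
  unfold digitIrr coeffIrr shiftIrr aIrr bIrr
  rw [prj_add_one]
  simp only [hi, if_false]
  by_cases h1 : i ∈ H <;> by_cases h2 : prj r i ∈ K <;> simp [h1, h2]

lemma digitIrr_of_eq_zero {p r : ℕ} {b : ZMod r → ℤ} {KJ K : Finset (ZMod r)}
    {H : Finset (ZMod (2 * r))} {i : ZMod (2 * r)} (hi : prj r i = 0) :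
    digitIrr p r b KJ K H i =
      (if i ∈ H ↔ prj r i ∈ K then cIrr p r b KJ 0 + 1 else dlt K 1)
        + if i + 1 ∈ H ∧ (1 : ZMod r) ∉ K then 1 else 0 := by
  unfold digitIrr coeffIrr shiftIrr aIrr bIrr
  rw [prj_add_one]
  simp only [hi, if_true, zero_add]
  by_cases h1 : i ∈ H <;> by_cases h2 : (0 : ZMod r) ∈ K <;> simp [h1, h2]
  ring

lemma cIrr_of_ne_zero_bounds {p r : ℕ} {b : ZMod r → ℤ}
    (hb : ∀ i : ZMod r, 2 ≤ b i ∧ b i ≤ (p : ℤ) - 2) (KJ : Finset (ZMod r)) {x : ZMod r} (hx : x ≠ 0) :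
    2 ≤ cIrr p r b KJ x + dlt KJ (x + 1) ∧ cIrr p r b KJ x + dlt KJ (x + 1) ≤ p - 2 := by
  have := hb x
  unfold cIrr
  simp only [hx, if_false]
  split_ifs <;> omega

lemma cIrr_zero_bounds {p r : ℕ} {b : ZMod r → ℤ}
    (hb : ∀ i : ZMod r, 2 ≤ b i ∧ b i ≤ (p : ℤ) - 2) (KJ : Finset (ZMod r)) :
    1 + dlt KJ 1 ≤ cIrr p r b KJ 0 ∧ cIrr p r b KJ 0 ≤ p - 3 + dlt KJ 1 := by
  have := hb 0
  unfold cIrr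
  simp only [if_true]
  split_ifs <;> omega

lemma dlt_nonneg {r : ℕ} (K : Finset (ZMod r)) (x : ZMod r) : 0 ≤ dlt K x := by
  unfold dlt
  split_ifs <;> norm_num

lemma dlt_le_one {r : ℕ} (K : Finset (ZMod r)) (x : ZMod r) : dlt K x ≤ 1 := by
  unfold dlt
  split_ifs <;> norm_num

section Digits

variable {p r : ℕ} {b : ZMod r → ℤ} {KJ K : Finset (ZMod r)} {H : Finset (ZMod (2 * r))}

lemma digitIrr_nonneg (hb : ∀ i : ZMod r, 2 ≤ b i ∧ b i ≤ (p : ℤ) - 2) (i : ZMod (2 * r)) :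
    0 ≤ digitIrr p r b KJ K H i := by
  have h1 := dlt_nonneg K 1
  have h2 := dlt_nonneg KJ 1
  have h3 := dlt_nonneg K (prj r i + 1)
  have h4 := dlt_le_one KJ (prj r i + 1)
  by_cases hi : prj r i = 0
  · rw [digitIrr_of_eq_zero hi]
    have := cIrr_zero_bounds hb KJ
    split_ifs <;> omega
  · rw [digitIrr_of_ne_zero hi]
    have := cIrr_of_ne_zero_bounds hb KJ hi
    split_ifs <;> omega

lemma digitIrr_le_one {i : ZMod (2 * r)} (h : ¬ (i ∈ H ↔ prj r i ∈ K)) :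
    digitIrr p r b KJ K H i ≤ 1 := by
  by_cases hi : prj r i = 0
  · rw [digitIrr_of_eq_zero hi, if_neg h, dlt]
    split_ifs <;> first | omega | tauto
  · rw [digitIrr_of_ne_zero hi, if_neg h]
    split_ifs <;> omega

lemma digitIrr_lt_of_ne_zero (hp5 : 5 ≤ p) (hb : ∀ i : ZMod r, 2 ≤ b i ∧ b i ≤ (p : ℤ) - 2)
    {i : ZMod (2 * r)} (hi : prj r i ≠ 0) : digitIrr p r b KJ K H i < p := by
  rw [digitIrr_of_ne_zero hi]
  have h1 := cIrr_of_ne_zero_bounds hb KJ hi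
  have h2 := dlt_nonneg KJ (prj r i + 1)
  have h3 := dlt_le_one K (prj r i + 1)
  by_cases h4 : prj r i + 1 ∈ K
  · rw [if_neg (c := _ ∧ _) (by tauto)]
    split_ifs <;> omega
  · simp only [dlt, h4, if_false] at h1 h2 h3 ⊢
    split_ifs at * <;> omega

lemma digitIrr_le_of_eq_zero (hb : ∀ i : ZMod r, 2 ≤ b i ∧ b i ≤ (p : ℤ) - 2)
    {i : ZMod (2 * r)} (hi : prj r i = 0) : digitIrr p r b KJ K H i ≤ p - 1 + dlt KJ 1 := by
  rw [digitIrr_of_eq_zero hi]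
  have h1 := cIrr_zero_bounds hb KJ
  have h2 := dlt_nonneg KJ 1
  have h3 := dlt_le_one K 1
  split_ifs <;> omega

lemma digitIrr_le (hp5 : 5 ≤ p) (hb : ∀ i : ZMod r, 2 ≤ b i ∧ b i ≤ (p : ℤ) - 2)
    (i : ZMod (2 * r)) : digitIrr p r b KJ K H i ≤ p := by
  by_cases hi : prj r i = 0
  · have := digitIrr_le_of_eq_zero (KJ := KJ) (K := K) (H := H) hb hi
    have := dlt_le_one KJ 1
    omega
  · exact (digitIrr_lt_of_ne_zero hp5 hb hi).le

variable [NeZero r] [NeZero (2 * r)] {J : Finset (ZMod (2 * r))}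

lemma IsFull.digitIrr_bounds (hJ : IsFull r J)
    (hb : ∀ i : ZMod r, 2 ≤ b i ∧ b i ≤ (p : ℤ) - 2)
    {i : ZMod (2 * r)} (hi : InFirstHalf r i) :
    2 ≤ digitIrr p r b (KJset r J) (KJset r J) J i ∧
      digitIrr p r b (KJset r J) (KJset r J) J i ≤ p - 1 := by
  have h1 := inFirstHalf_add_one_iff i
  have h2 := hJ.mem_iff i
  have h3 := hJ.mem_iff (i + 1)
  rw [prj_add_one] at h3
  by_cases h0 : prj r i = 0
  · rw [digitIrr_of_eq_zero h0, if_pos (by tauto)]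
    rw [h0, zero_add] at h3
    have h4 := cIrr_zero_bounds hb (KJset r J)
    by_cases h5 : (1 : ZMod r) ∈ KJset r J
    · rw [if_neg (by tauto)]
      simp only [dlt, h5, if_true] at h4
      omega
    · rw [if_pos (by tauto)]
      simp only [dlt, h5, if_false] at h4
      omega
  · rw [digitIrr_of_ne_zero h0, if_pos (by tauto), if_neg (by tauto)]
    have h4 := cIrr_of_ne_zero_bounds hb (KJset r J) h0
    omega

lemma IsFull.digitIrr_zero (hJ : IsFull r J) :
    digitIrr p r b (KJset r J) (KJset r J) J 0 = dlt (KJset r J) 1 := by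
  have h0 : ¬ InFirstHalf r (0 : ZMod (2 * r)) := by simp [InFirstHalf]
  have h1 := inFirstHalf_add_one_iff (0 : ZMod (2 * r))
  have h2 := hJ.mem_iff 0
  have h3 := hJ.mem_iff (0 + 1)
  rw [prj_add_one] at h3
  have h4 : prj r 0 = 0 := map_zero _
  rw [digitIrr_of_eq_zero h4, if_neg (by tauto), if_neg, add_zero]
  rw [h4, zero_add (1 : ZMod r)] at h3
  tauto

end Digits

/-- The digits for `K'` and for `K_J` differ by no carries. -/
lemma digitIrr_eq_of_carries {p r : ℕ} [NeZero r] [NeZero (2 * r)] (hp5 : 5 ≤ p)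
    {b : ZMod r → ℤ} (hb : ∀ i : ZMod r, 2 ≤ b i ∧ b i ≤ (p : ℤ) - 2)
    {J J' : Finset (ZMod (2 * r))} (hJ : IsFull r J) {K' : Finset (ZMod r)}
    {t : ZMod (2 * r) → ℤ}
    (ht : ∀ i, digitIrr p r b (KJset r J) K' J' i - digitIrr p r b (KJset r J) (KJset r J) J i
      + t (i + 1) = p * t i) (i : ZMod (2 * r)) :
    digitIrr p r b (KJset r J) K' J' i = digitIrr p r b (KJset r J) (KJset r J) J i := by
  set R := digitIrr p r b (KJset r J) K' J'
  set L := digitIrr p r b (KJset r J) (KJset r J) J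
  have hR0 : ∀ i, 0 ≤ R i := digitIrr_nonneg hb
  have hL0 : ∀ i, 0 ≤ L i := digitIrr_nonneg hb
  have hRp : ∀ i, R i ≤ p := digitIrr_le hp5 hb
  have hLp : ∀ i, L i ≤ p := digitIrr_le hp5 hb
  have hLz : L 0 = dlt (KJset r J) 1 := hJ.digitIrr_zero
  have hδ0 := dlt_nonneg (KJset r J) 1
  have hδ1 := dlt_le_one (KJset r J) 1
  have hRz : R 0 ≤ p - 1 + dlt (KJset r J) 1 := digitIrr_le_of_eq_zero hb (map_zero _)
  have ht1 : ∀ i, |t i| ≤ 1 := abs_carry_le_one (by omega)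
    (fun i => abs_le.2 ⟨by linarith [hR0 i, hLp i], by linarith [hRp i, hL0 i]⟩) ht
  have hcase : ∀ i, t i = -1 ∨ t i = 0 ∨ t i = 1 := fun i => by
    have := abs_le.1 (ht1 i)
    omega
  have ht0 : ∀ i, 0 ≤ t i := by
    intro i
    by_contra! hneg
    have hstep : ∀ j, t j = -1 → t (j + 1) = -1 := by
      intro j hj
      have h1 := ht j
      have hLj : L j ≤ p - 1 ∨ j = 0 ∨ prj r j ≠ 0 := by
        by_cases h : InFirstHalf r j
        · exact Or.inl (hJ.digitIrr_bounds hb h).2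
        · by_cases h0 : prj r j = 0
          · exact Or.inr (Or.inl (eq_zero_of_not_inFirstHalf h h0))
          · exact Or.inr (Or.inr h0)
      have hLj' : L j ≤ p - 1 := by
        rcases hLj with h | rfl | h
        · exact h
        · omega
        · exact Int.le_sub_one_of_lt (digitIrr_lt_of_ne_zero hp5 hb h)
      rw [hj] at h1
      have := hR0 j
      rcases hcase (j + 1) with h | h | h <;> omega
    have hall : ∀ m : ℕ, t (i + m) = -1 := by
      intro m
      induction m with
      | zero =>
        rw [Nat.cast_zero, add_zero]
        rcases hcase i with h | h | h <;> omega
      | succ m ih =>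
        rw [Nat.cast_succ, ← add_assoc]
        exact hstep _ ih
    have h0 := hall (-i).val
    rw [ZMod.natCast_zmod_val, add_neg_cancel] at h0
    have h1 := ht 0
    rw [hstep 0 h0, h0] at h1
    have := hR0 0
    omega
  have hfirst : ∀ i, InFirstHalf r i → t i = 0 := by
    intro i hi
    have h1 := ht i
    have h2 : 2 ≤ L i := (hJ.digitIrr_bounds hb hi).1
    have h3 := hRp i
    rcases hcase i with h | h | h
    · linarith [ht0 i]
    · exact h
    · rw [h] at h1
      rcases hcase (i + 1) with h | h | h <;> omega
  have hzero : t 0 = 0 := by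
    have h1 := ht 0
    rw [hfirst (0 + 1) ((inFirstHalf_add_one_iff 0).2 (by simp [InFirstHalf]))] at h1
    rcases hcase 0 with h | h | h
    · linarith [ht0 0]
    · exact h
    · rw [h] at h1
      omega
  have hall : ∀ m : ℕ, t (-m) = 0 := by
    intro m
    induction m with
    | zero => simpa using hzero
    | succ m ih =>
      set j : ZMod (2 * r) := -((m + 1 : ℕ) : ZMod (2 * r)) with hj
      have hj1 : j + 1 = -m := by
        rw [hj]
        push_cast
        ring
      by_cases h : InFirstHalf r j
      · exact hfirst j h
      · by_cases h0 : prj r j = 0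
        · rw [eq_zero_of_not_inFirstHalf h h0]
          exact hzero
        · have h1 := ht j
          rw [hj1, ih] at h1
          have h2 : R j < p := digitIrr_lt_of_ne_zero hp5 hb h0
          have h3 := hL0 j
          rcases hcase j with h | h | h
          · linarith [ht0 j]
          · exact h
          · rw [h] at h1
            omega
  have hall' : ∀ i, t i = 0 := fun i => by
    have := hall (-i).val
    rwa [ZMod.natCast_zmod_val, neg_neg] at this
  have := ht i
  rw [hall', hall'] at this
  linarith

lemma eq_KJset_of_digitIrr_eq {p r : ℕ} [NeZero r] [NeZero (2 * r)]
    {b : ZMod r → ℤ} (hb : ∀ i : ZMod r, 2 ≤ b i ∧ b i ≤ (p : ℤ) - 2)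
    {J J' : Finset (ZMod (2 * r))} (hJ : IsFull r J) (hJ' : IsFull r J') {K' : Finset (ZMod r)}
    (h : ∀ i, digitIrr p r b (KJset r J) K' J' i
      = digitIrr p r b (KJset r J) (KJset r J) J i) :
    K' = KJset r J := by
  have hfirst : ∀ i, InFirstHalf r i → (i ∈ J' ↔ prj r i ∈ K') := by
    intro i hi
    by_contra hc
    have h1 := digitIrr_le_one (p := p) (b := b) (KJ := KJset r J) hc
    have h2 := (hJ.digitIrr_bounds hb hi).1
    rw [h i] at h1
    omega
  have hmem : ∀ i, i ∈ J' ↔ (InFirstHalf r i ↔ prj r i ∈ K') := by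
    intro i
    by_cases hi : InFirstHalf r i
    · have := hfirst i hi
      tauto
    · have h1 := hfirst (i + r) ((inFirstHalf_add_self i).2 hi)
      rw [prj_add_self, hJ'.add_mem_iff] at h1
      tauto
  have hsecond : ∀ (K : Finset (ZMod r)) (H : Finset (ZMod (2 * r))),
      (∀ i, i ∈ H ↔ (InFirstHalf r i ↔ prj r i ∈ K)) → ∀ i, ¬ InFirstHalf r i →
      digitIrr p r b (KJset r J) K H i
        = if prj r i = 0 ↔ prj r i + 1 ∈ K then 1 else 0 := by
    intro K H hH i hi
    have h1 := inFirstHalf_add_one_iff i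
    have h2 := hH i
    have h3 := hH (i + 1)
    rw [prj_add_one] at h3
    by_cases h0 : prj r i = 0
    · rw [digitIrr_of_eq_zero h0, if_neg (by tauto)]
      rw [h0, zero_add] at h3 ⊢
      rw [if_neg (by tauto)]
      simp [dlt]
    · rw [digitIrr_of_ne_zero h0, if_neg (by tauto), zero_add]
      exact if_congr (by tauto) rfl rfl
  ext x
  obtain ⟨i, hi, hni⟩ := exists_prj_eq_not_inFirstHalf (x - 1)
  have h1 := h i
  rw [hsecond _ _ hmem i hni, hsecond _ _ hJ.mem_iff i hni, hi, sub_add_cancel] at h1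
  split_ifs at h1 <;> first | omega | tauto

/-- The combinatorial content of Proposition `typeswts2` (irreducible case):
if `J'` is a full subset of `ℤ/2rℤ`, `K' ⊆ ℤ/rℤ`, and the displayed congruence
modulo `p^{2r} − 1` holds, then `K' = K_J`. -/
theorem stmt16 (p r : ℕ) [NeZero r] [NeZero (2 * r)] (hp : p.Prime) (hp5 : 5 ≤ p)
    (b : ZMod r → ℤ) (hb : ∀ i : ZMod r, 2 ≤ b i ∧ b i ≤ (p : ℤ) - 2)
    (J : Finset (ZMod (2 * r))) (hJ : IsFull r J)
    (J' : Finset (ZMod (2 * r))) (hJ' : IsFull r J')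
    (K' : Finset (ZMod r))
    (hcong :
      (∑ i : ZMod (2 * r), aIrr p r b (KJset r J) (KJset r J) (prj r i) * wgt2 p r i) +
        (∑ i ∈ J, bIrr p r b (KJset r J) (KJset r J) (prj r i) * wgt2 p r i) ≡
      (∑ i : ZMod (2 * r), aIrr p r b (KJset r J) K' (prj r i) * wgt2 p r i) +
        (∑ i ∈ J', bIrr p r b (KJset r J) K' (prj r i) * wgt2 p r i)
      [ZMOD (p : ℤ) ^ (2 * r) - 1]) :
    K' = KJset r J := by
  have hdvd : (p : ℤ) ^ (2 * r) - 1 ∣ ∑ i, (coeffIrr p r b (KJset r J) K' J' i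
      - coeffIrr p r b (KJset r J) (KJset r J) J i) * wgt2 p r i := by
    simp only [sub_mul, sum_sub_distrib, sum_coeffIrr]
    exact hcong.dvd
  obtain ⟨u, hu⟩ := exists_carries hp.ne_zero _ hdvd
  refine eq_KJset_of_digitIrr_eq hb hJ hJ' (digitIrr_eq_of_carries hp5 hb hJ
    (t := fun i => u i - shiftIrr r K' J' i + shiftIrr r (KJset r J) J i) fun i => ?_)
  unfold digitIrr
  linear_combination hu i
end
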